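/- Axiomatic characterization of the tree invariants (content of the identification with Milnor's μ-invariants): for each n ≥ 1, each I = {i_1 < … < i_r} ⊆ {1,…,n} (possibly empty) and each j < min I, let F_{I,j} be a ℤ-valued function of Gauss diagrams on n strings such that: (i) F_{∅,j} ≡ 1; (ii) each F_{I,j} is invariant under the Reidemeister moves Ω1, Ω2, Ω3; (iii) F_{I,j}(G) is unchanged when one deletes from G any arrow that does not have its tail on a string of I and its head on a different string of I∪{j}; (iv) for every 1 ≤ k ≤ r and every skein quadruple (G_+, G_−, G_0, G_∞) at a crossing between strings j and i_k, F_{I,j}(G_+) − F_{I,j}(G_−) = F_{I_k^-, j}(G_∞) · F_{I_k^+, i_k}(G_0), where I_k^- = {i_1,…,i_{k−1}} and I_k^+ = {i_{k+1},…,i_r}; and (v) F_{I,j}(G) = 0 whenever I ≠ ∅ and no arrow of G has its head on string j. Then F_{I,j}(G) = Z_{I,j}(G) for every Gauss diagram G, every such I and every j < min I. (The tree invariants Z_{I,j} satisfy (i)–(v); Milnor's link-homotopy μ-invariants μ_{i_1…i_r, j} of tangles satisfy the same skein relation and normalization, whence Z_{I,j} = μ_{i_1…i_r, j} for j < i_1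 < … < i_r.) -/

import Mathlib

/-!
Combinatorial Gauss diagrams on `n` strings and the tree invariants `Z I j`.

A Gauss diagram is encoded by a finite set of arrows; each arrow records the
string (an element of `Fin n`) and the position (a rational number, increasing
in the direction of the orientation of the string) of its tail and of its head,
together with a sign `±1`.  Only the induced combinatorial data (linear order of
the endpoints along each string, the tail/head pairing and the signs) is ever
used by the definitions below.

The tree invariant `Z I j G = ∑_{A ∈ 𝒜_{I,j}} sign(A) ⟨A, G⟩` is computed as a
signed count over all subsets `S` of the arrows of `G` that form a planar tree
diagram with leaves on `I` and trunk on `j`: each pair `(A, φ)` of a planar tree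
diagram `A ∈ 𝒜_{I,j}` together with an embedding `φ : A → G` corresponds
bijectively to the subset `S = Im φ` of the arrows of `G`, which is itself a
planar tree diagram with leaves on `I` and trunk on `j`; the contribution of the
pair to the sum is `sign(A) · sign(φ) = (-1)^{#right-pointing arrows of S} · ∏_{a ∈ S} sign(a)`.
-/

open scoped Classical

/-- An arrow of a Gauss diagram on `n` strings: a tail endpoint, a head
endpoint (each given by the string it lies on and its position along that
string) and a sign. -/
structure GArrow (n : ℕ) where
  tailStr : Fin n
  tailPos : ℚ
  headStr : Fin n
  headPos : ℚ
  sign : ℤ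
deriving DecidableEq

namespace GArrow

/-- The two endpoints of an arrow: `false` is the tail, `true` is the head. -/
def ep {n : ℕ} (a : GArrow n) : Bool → Fin n × ℚ
  | false => (a.tailStr, a.tailPos)
  | true => (a.headStr, a.headPos)

end GArrow

/-- A Gauss diagram on `n` strings: a finite set of signed arrows with all
endpoints pairwise distinct, and all signs equal to `±1`. -/
structure GaussDiagram (n : ℕ) where
  arrows : Finset (GArrow n)
  sign_pm : ∀ a ∈ arrows, a.sign = 1 ∨ a.sign = -1
  endpoints_distinct : ∀ a ∈ arrows, ∀ b ∈ arrows, ∀ s t : Bool,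
    a.ep s = b.ep t → a = b ∧ s = t

/-- `S` is a tree diagram with leaves on `I` and trunk on `j`:
* the head and the tail of every arrow lie on different strings;
* for each `i ∈ I` there is exactly one arrow tail on string `i`, and there are
  no arrow tails on strings outside `I`;
* every arrow head lies on a string of `I ∪ {j}`;
* on each string `i ∈ I` all arrow heads precede the unique arrow tail. -/
def IsTreeDiagram {n : ℕ} (I : Finset (Fin n)) (j : Fin n)
    (S : Finset (GArrow n)) : Prop :=
  (∀ a ∈ S, a.tailStr ≠ a.headStr) ∧
  (∀ i ∈ I, ∃! a, a ∈ S ∧ a.tailStr = i) ∧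
  (∀ a ∈ S, a.tailStr ∈ I) ∧
  (∀ a ∈ S, a.headStr ∈ I ∨ a.headStr = j) ∧
  (∀ a ∈ S, ∀ b ∈ S, a.headStr = b.tailStr → a.headPos < b.tailPos)

/-- `ParentRel S s t` : string `s` is the parent of string `t` in the rooted
tree determined by the tree diagram `S`, i.e. the (unique) arrow with tail on
`t` has its head on `s`. -/
def ParentRel {n : ℕ} (S : Finset (GArrow n)) (s t : Fin n) : Prop :=
  ∃ a ∈ S, a.tailStr = t ∧ a.headStr = s

/-- `Descends S s k` : string `k` belongs to the subtree of string `s` (it is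
`s` itself or an iterated child of `s`). -/
def Descends {n : ℕ} (S : Finset (GArrow n)) : Fin n → Fin n → Prop :=
  Relation.ReflTransGen (ParentRel S)

/-- `S` is a *planar* tree diagram with leaves on `I` and trunk on `j`: the
rooted tree `T_S` determined by `S` can be drawn in the plane so that the
clockwise order of its leaves, starting from the root on string `j`, is the
order of the string numbers.  Combinatorially this says that:
* the parent relation makes the strings carrying the arrows into a tree rooted
  at `j` (every leaf string is an iterated child of `j`);
* the whole subtree hanging from an arrow lies on the same side of the string
  carrying the head of that arrow as its tail does;
* two subtrees hanging on the same side of a common string are ordered, along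
  that string, compatibly with the order of the strings: for two arrow heads on
  the same string, with both tails on the left, the subtree attached closer to
  the beginning of the string is the one carrying the larger string numbers,
  while for two tails on the right it is the one carrying the smaller string
  numbers. -/
def IsPlanarTreeDiagram {n : ℕ} (I : Finset (Fin n)) (j : Fin n)
    (S : Finset (GArrow n)) : Prop :=
  IsTreeDiagram I j S ∧
  (∀ i ∈ I, Relation.TransGen (ParentRel S) j i) ∧
  (∀ a ∈ S, ∀ k : Fin n, Descends S a.tailStr k →
    (a.tailStr < a.headStr ↔ k < a.headStr)) ∧
  (∀ a ∈ S, ∀ b ∈ S, a.headStr = b.headStr → a.headPos < b.headPos →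
    ∀ k k' : Fin n, Descends S a.tailStr k → Descends S b.tailStr k' →
      ((a.tailStr < a.headStr → b.tailStr < b.headStr → k' < k) ∧
       (a.headStr < a.tailStr → b.headStr < b.tailStr → k < k')))

/-- The sign `(-1)^q` of an (embedded) arrow diagram, where `q` is the number
of right-pointing arrows (tail on a string of smaller number than the head). -/
noncomputable def treeSign {n : ℕ} (S : Finset (GArrow n)) : ℤ :=
  (-1) ^ (S.filter fun a => a.tailStr < a.headStr).card

/-- The tree invariant `Z_{I,j}(G) = ∑_{A ∈ 𝒜_{I,j}} sign(A)·⟨A,G⟩`, computed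
as the signed count of embedded planar tree diagrams with leaves on `I` and
trunk on `j` inside `G`.  In particular `Z ∅ j G = 1` (only `S = ∅`
contributes). -/
noncomputable def Z {n : ℕ} (I : Finset (Fin n)) (j : Fin n)
    (G : GaussDiagram n) : ℤ :=
  ∑ S ∈ G.arrows.powerset,
    if IsPlanarTreeDiagram I j S then treeSign S * ∏ a ∈ S, a.sign else 0

/-- The two points at positions `p` and `q` on string `str` are adjacent in the
Gauss diagram `G`: no arrow endpoint of `G` lies strictly between them. -/
def IsAdjacentPair {n : ℕ} (G : GaussDiagram n) (str : Fin n) (p q : ℚ) : Prop :=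
  p ≠ q ∧ ∀ c ∈ G.arrows, ∀ s : Bool, (c.ep s).1 = str →
    ¬(min p q < (c.ep s).2 ∧ (c.ep s).2 < max p q)

/-- The sign `±1` associated to a Boolean. -/
def bsign (b : Bool) : ℤ := if b then 1 else -1

/-- The arrow with endpoints `(s1, p1)` and `(s2, p2)` and sign `sg`, whose
tail is on `s1` if `d = true` and on `s2` if `d = false`. -/
def mkDirArrow {n : ℕ} (d : Bool) (s1 : Fin n) (p1 : ℚ) (s2 : Fin n) (p2 : ℚ)
    (sg : ℤ) : GArrow n :=
  if d then ⟨s1, p1, s2, p2, sg⟩ else ⟨s2, p2, s1, p1, sg⟩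

/-- First Reidemeister move (deletion direction): `G'` is obtained from `G` by
deleting one arrow whose two endpoints are adjacent on a single string. -/
def Omega1Del {n : ℕ} (G G' : GaussDiagram n) : Prop :=
  ∃ a ∈ G.arrows, a.tailStr = a.headStr ∧
    IsAdjacentPair G a.tailStr a.tailPos a.headPos ∧
    G'.arrows = G.arrows.erase a

/-- First Reidemeister move: insertion or deletion of an isolated arrow with
both (adjacent) endpoints on a single string. -/
def Omega1Rel {n : ℕ} (G G' : GaussDiagram n) : Prop :=
  Omega1Del G G' ∨ Omega1Del G' G

/-- Second Reidemeister move (deletion direction): `G'` is obtained from `G` by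
deleting a pair of arrows of opposite signs joining the same two strings in the
same direction, whose tails are adjacent and whose heads are adjacent, the
arrow whose tail comes first being the one whose head comes second. -/
def Omega2Del {n : ℕ} (G G' : GaussDiagram n) : Prop :=
  ∃ a ∈ G.arrows, ∃ b ∈ G.arrows, a ≠ b ∧
    a.tailStr = b.tailStr ∧ a.headStr = b.headStr ∧ a.sign = -b.sign ∧
    IsAdjacentPair G a.tailStr a.tailPos b.tailPos ∧
    IsAdjacentPair G a.headStr a.headPos b.headPos ∧
    ((a.tailPos < b.tailPos ∧ b.headPos < a.headPos) ∨
     (b.tailPos < a.tailPos ∧ a.headPos < b.headPos)) ∧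
    G'.arrows = (G.arrows.erase a).erase b

/-- Second Reidemeister move: insertion or deletion of such a pair of arrows. -/
def Omega2Rel {n : ℕ} (G G' : GaussDiagram n) : Prop :=
  Omega2Del G G' ∨ Omega2Del G' G

/-- Third Reidemeister move on Gauss diagrams: three string fragments (on the
strings `sX`, `sY`, `sZ`, not necessarily distinct) carry the six endpoints of
three arrows `a` (joining the first and second fragments), `b` (first and
third) and `c` (second and third); on each fragment the two endpoints are
adjacent, and the move simultaneously transposes the two endpoints on each
fragment, preserving the directions and the signs of the three arrows.

Exactly the configurations arising from the oriented third Reidemeister move on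
tangle diagrams (sliding the first strand, which passes entirely over or
entirely under the other two, across the crossing of the other two strands) are
allowed; they are parametrised by the five Booleans `u` (the sliding strand
passes over), `w` (the second strand passes over the third at their crossing)
and `ox`, `oy`, `oz` (the orientations of the three strands in the standard
local picture), which determine the directions, the signs and the mutual order
of the endpoints of the three arrows, as obtained by computing the writhes in
the local picture. -/
def Omega3Rel {n : ℕ} (G G' : GaussDiagram n) : Prop :=
  ∃ (sX sY sZ : Fin n) (xa xb ya yc zb zc : ℚ) (u w ox oy oz : Bool),
    mkDirArrow u sX xa sY ya (bsign u * bsign ox * bsign oy) ∈ G.arrows ∧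
    mkDirArrow u sX xb sZ zb (-(bsign u * bsign ox * bsign oz)) ∈ G.arrows ∧
    mkDirArrow w sY yc sZ zc (-(bsign w * bsign oy * bsign oz)) ∈ G.arrows ∧
    (if ox then xa < xb else xb < xa) ∧
    (if oy then ya < yc else yc < ya) ∧
    (if oz then zc < zb else zb < zc) ∧
    IsAdjacentPair G sX xa xb ∧ IsAdjacentPair G sY ya yc ∧
    IsAdjacentPair G sZ zb zc ∧
    G'.arrows =
      (((G.arrows.erase
            (mkDirArrow u sX xa sY ya (bsign u * bsign ox * bsign oy))).erase
            (mkDirArrow u sX xb sZ zb (-(bsign u * bsign ox * bsign oz)))).erase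
            (mkDirArrow w sY yc sZ zc (-(bsign w * bsign oy * bsign oz)))) ∪
        {mkDirArrow u sX xb sY yc (bsign u * bsign ox * bsign oy),
         mkDirArrow u sX xa sZ zc (-(bsign u * bsign ox * bsign oz)),
         mkDirArrow w sY ya sZ zb (-(bsign w * bsign oy * bsign oz))}

/-- A single Reidemeister move on Gauss diagrams. -/
def ReidMove {n : ℕ} (G G' : GaussDiagram n) : Prop :=
  Omega1Rel G G' ∨ Omega2Rel G G' ∨ Omega3Rel G G'

/-- Reversing the orientation of string `i`: the linear order of the endpoints
on string `i` is reversed (positions are negated) and the sign of every arrow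
with exactly one endpoint on string `i` is multiplied by `-1`. -/
def reverseArrow {n : ℕ} (i : Fin n) (a : GArrow n) : GArrow n where
  tailStr := a.tailStr
  tailPos := if a.tailStr = i then -a.tailPos else a.tailPos
  headStr := a.headStr
  headPos := if a.headStr = i then -a.headPos else a.headPos
  sign := if (a.tailStr = i ∧ a.headStr ≠ i) ∨ (a.tailStr ≠ i ∧ a.headStr = i)
    then -a.sign else a.sign

/-- The position of the endpoint of the arrow `a` lying on string `s` (for an
arrow joining `s` to a different string). -/
def posOn {n : ℕ} (a : GArrow n) (s : Fin n) : ℚ :=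
  if a.tailStr = s then a.tailPos else a.headPos

/-- The oriented smoothing at a crossing of strings `j` and `i` located at
position `pj` on string `j` and position `pi` on string `i`: the final portions
of the two strings are exchanged, i.e. an endpoint on string `j` after `pj`
moves to string `i` (after `pi`, in the same order) and vice versa. -/
def smoothEp {n : ℕ} (j i : Fin n) (pj pi : ℚ) (e : Fin n × ℚ) : Fin n × ℚ :=
  if e.1 = j ∧ pj < e.2 then (i, pi + (e.2 - pj))
  else if e.1 = i ∧ pi < e.2 then (j, pj + (e.2 - pi))
  else e

/-- The effect of the oriented smoothing on an arrow. -/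
def smoothArrow {n : ℕ} (j i : Fin n) (pj pi : ℚ) (a : GArrow n) : GArrow n where
  tailStr := (smoothEp j i pj pi (a.tailStr, a.tailPos)).1
  tailPos := (smoothEp j i pj pi (a.tailStr, a.tailPos)).2
  headStr := (smoothEp j i pj pi (a.headStr, a.headPos)).1
  headPos := (smoothEp j i pj pi (a.headStr, a.headPos)).2
  sign := a.sign

/-- `(Gp, Gm, G0, Ginf)` is a skein quadruple at a crossing between strings `j`
and `i`:
* `Gp` has a distinguished arrow `a` of sign `+1` joining strings `j` and `i`
  (in either direction);
* `Gm` is obtained from `Gp` by switching the crossing (exchanging the tail and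
  the head of `a` and changing its sign to `-1`);
* `G0` is obtained by deleting `a` and exchanging the final portions of strings
  `j` and `i` at the positions of `a` (the oriented smoothing);
* `Ginf` is obtained by first reversing the orientation of string `i` and then
  smoothing at `a` respecting the new orientations. -/
def IsSkeinQuadruple {n : ℕ} (j i : Fin n) (Gp Gm G0 Ginf : GaussDiagram n) :
    Prop :=
  j ≠ i ∧
  ∃ a ∈ Gp.arrows, a.sign = 1 ∧
    ((a.tailStr = j ∧ a.headStr = i) ∨ (a.tailStr = i ∧ a.headStr = j)) ∧
    Gm.arrows =
      insert (GArrow.mk a.headStr a.headPos a.tailStr a.tailPos (-1))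
        (Gp.arrows.erase a) ∧
    G0.arrows =
      (Gp.arrows.erase a).image (smoothArrow j i (posOn a j) (posOn a i)) ∧
    Ginf.arrows =
      ((Gp.arrows.image (reverseArrow i)).erase (reverseArrow i a)).image
        (smoothArrow j i (posOn a j) (-(posOn a i)))

namespace GaussDiagram

/-- The effect on arrows of reversing the string of the tail of `a` and smoothing at `a`. -/
noncomputable def lowerMap {n : ℕ} (a b : GArrow n) : GArrow n :=
  smoothArrow a.headStr a.tailStr a.headPos (-a.tailPos) (reverseArrow a.tailStr b)

/-- The effect on arrows of the oriented smoothing at `a`. -/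
noncomputable def upperMap {n : ℕ} (a b : GArrow n) : GArrow n :=
  smoothArrow a.headStr a.tailStr a.headPos a.tailPos b

/-- The arrow `b` may belong to the part of a planar tree through `a` whose leaves are
smaller than the tail of `a`. -/
def IsLower {n : ℕ} (I : Finset (Fin n)) (a b : GArrow n) : Prop :=
  b.tailStr ∈ I ∧ b.tailStr < a.tailStr ∧
    ((b.headStr ∈ I ∧ b.headStr < a.tailStr) ∨
      (b.headStr = a.headStr ∧ b.headPos < a.headPos) ∨
      (b.headStr = a.tailStr ∧ b.headPos < a.tailPos))

/-- The arrow `b` may belong to the part of a planar tree through `a` whose leaves are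
larger than the tail of `a`. -/
def IsUpper {n : ℕ} (I : Finset (Fin n)) (a b : GArrow n) : Prop :=
  b.tailStr ∈ I ∧ a.tailStr < b.tailStr ∧
    ((b.headStr ∈ I ∧ a.tailStr < b.headStr) ∨
      (b.headStr = a.headStr ∧ a.headPos < b.headPos) ∨
      (b.headStr = a.tailStr ∧ b.headPos < a.tailPos))

section maps

variable {n : ℕ} {j i : Fin n}

lemma smoothEp_involutive (h : j ≠ i) (pj pi : ℚ) :
    Function.Involutive (smoothEp j i pj pi) := by
  rintro ⟨s, p⟩
  unfold smoothEp
  grind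

lemma ep_smoothArrow (pj pi : ℚ) (b : GArrow n) (s : Bool) :
    (smoothArrow j i pj pi b).ep s = smoothEp j i pj pi (b.ep s) := by
  cases s <;> rfl

lemma arrow_ext {a b : GArrow n} (h : ∀ s, a.ep s = b.ep s) (hs : a.sign = b.sign) : a = b := by
  have h1 := h false
  have h2 := h true
  cases a
  cases b
  simp_all [GArrow.ep]

lemma smoothArrow_injective (h : j ≠ i) (pj pi : ℚ) :
    Function.Injective (smoothArrow j i pj pi) := by
  intro a b hab
  refine arrow_ext (fun s => (smoothEp_involutive h pj pi).injective ?_) ?_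
  · rw [← ep_smoothArrow, ← ep_smoothArrow, hab]
  · simpa [smoothArrow] using congrArg GArrow.sign hab

lemma reverseArrow_involutive (i : Fin n) : Function.Involutive (reverseArrow i) := by
  rintro ⟨s, p, t, q, e⟩
  simp only [reverseArrow, GArrow.mk.injEq, true_and]
  grind

lemma ep_reverseArrow (i : Fin n) (b : GArrow n) (s : Bool) :
    (reverseArrow i b).ep s = ((b.ep s).1, if (b.ep s).1 = i then -(b.ep s).2 else (b.ep s).2) := by
  cases s <;> rfl

lemma ep_eq_of_reverseArrow {i : Fin n} {a b : GArrow n} {s t : Bool}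
    (h : (reverseArrow i a).ep s = (reverseArrow i b).ep t) : a.ep s = b.ep t := by
  rw [ep_reverseArrow, ep_reverseArrow] at h
  ext <;> grind

lemma lowerMap_injective {a : GArrow n} (h : a.headStr ≠ a.tailStr) :
    Function.Injective (lowerMap a) :=
  (smoothArrow_injective h _ _).comp (reverseArrow_involutive _).injective

lemma upperMap_injective {a : GArrow n} (h : a.headStr ≠ a.tailStr) :
    Function.Injective (upperMap a) :=
  smoothArrow_injective h _ _

lemma lowerMap_of_isLower {I : Finset (Fin n)} {a b : GArrow n}
    (hj : ∀ x ∈ I, a.headStr < x) (h : IsLower I a b) :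
    (lowerMap a b).tailStr = b.tailStr ∧ (lowerMap a b).tailPos = b.tailPos ∧
    (lowerMap a b).headStr = (if b.headStr = a.tailStr then a.headStr else b.headStr) ∧
    (lowerMap a b).headPos =
      (if b.headStr = a.tailStr then a.headPos + (a.tailPos - b.headPos) else b.headPos) ∧
    (lowerMap a b).sign = if b.headStr = a.tailStr then -b.sign else b.sign := by
  obtain ⟨h1, h2, h3⟩ := h
  have := hj _ h1
  simp only [lowerMap, smoothArrow, smoothEp, reverseArrow]
  grind

lemma upperMap_of_isUpper {I : Finset (Fin n)} {a b : GArrow n}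
    (hj : ∀ x ∈ I, a.headStr < x) (hi : a.tailStr ∈ I) (h : IsUpper I a b) :
    (upperMap a b).tailStr = b.tailStr ∧ (upperMap a b).tailPos = b.tailPos ∧
    (upperMap a b).headStr = (if b.headStr = a.headStr then a.tailStr else b.headStr) ∧
    (upperMap a b).headPos =
      (if b.headStr = a.headStr then a.tailPos + (b.headPos - a.headPos) else b.headPos) ∧
    (upperMap a b).sign = b.sign := by
  obtain ⟨h1, h2, h3⟩ := h
  have := hj _ h1
  have := hj _ hi
  simp only [upperMap, smoothArrow, smoothEp]
  grind

lemma isLower_of_lowerMap {I : Finset (Fin n)} {a b : GArrow n}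
    (hj : ∀ x ∈ I, a.headStr < x) (hi : a.tailStr ∈ I) (hab : ∀ s t, b.ep s ≠ a.ep t)
    (ht : (lowerMap a b).tailStr ∈ I.filter (· < a.tailStr))
    (hh : (lowerMap a b).headStr ∈ I.filter (· < a.tailStr) ∨
      (lowerMap a b).headStr = a.headStr) : IsLower I a b := by
  have := hj _ hi
  have h1 := hab true true
  have h2 := hab true false
  simp only [GArrow.ep, ne_eq, Prod.mk.injEq, not_and] at h1 h2
  simp only [lowerMap, smoothArrow, smoothEp, reverseArrow, Finset.mem_filter] at ht hh
  unfold IsLower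
  grind

lemma isUpper_of_upperMap {I : Finset (Fin n)} {a b : GArrow n}
    (hj : ∀ x ∈ I, a.headStr < x) (hi : a.tailStr ∈ I) (hab : ∀ s t, b.ep s ≠ a.ep t)
    (ht : (upperMap a b).tailStr ∈ I.filter (a.tailStr < ·))
    (hh : (upperMap a b).headStr ∈ I.filter (a.tailStr < ·) ∨
      (upperMap a b).headStr = a.tailStr) : IsUpper I a b := by
  have := hj _ hi
  have h1 := hab true true
  have h2 := hab true false
  simp only [GArrow.ep, ne_eq, Prod.mk.injEq, not_and] at h1 h2
  simp only [upperMap, smoothArrow, smoothEp, Finset.mem_filter] at ht hh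
  unfold IsUpper
  grind

end maps

section trees

variable {n : ℕ}

lemma descends_congr {S T : Finset (GArrow n)} {K : Fin n → Prop}
    (hK : ∀ k m, K k → ParentRel S k m → K m)
    (h : ∀ k m, K k → (ParentRel S k m ↔ ParentRel T k m)) {k m : Fin n} (hk : K k) :
    (Descends S k m ↔ Descends T k m) ∧ (Descends S k m → K m) := by
  have key : ∀ m, Descends S k m → Descends T k m ∧ K m := by
    intro m hm
    induction hm with
    | refl => exact ⟨.refl, hk⟩
    | tail _ hr ih => exact ⟨ih.1.tail ((h _ _ ih.2).1 hr), hK _ _ ih.2 hr⟩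
  have key' : ∀ m, Descends T k m → Descends S k m ∧ K m := by
    intro m hm
    induction hm with
    | refl => exact ⟨.refl, hk⟩
    | tail _ hr ih =>
      have := (h _ _ ih.2).2 hr
      exact ⟨ih.1.tail this, hK _ _ ih.2 this⟩
  exact ⟨⟨fun hm => (key m hm).1, fun hm => (key' m hm).1⟩, fun hm => (key m hm).2⟩

variable {I : Finset (Fin n)} {a : GArrow n} {L U : Finset (GArrow n)}

lemma descends_lower_iff (hj : ∀ x ∈ I, a.headStr < x) (hi : a.tailStr ∈ I)
    (hL : ∀ b ∈ L, IsLower I a b) (hU : ∀ b ∈ U, IsUpper I a b)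
    {k m : Fin n} (hk : k ∈ I ∧ k < a.tailStr) :
    (Descends (insert a (L ∪ U)) k m ↔ Descends (L.image (lowerMap a)) k m) ∧
      (Descends (insert a (L ∪ U)) k m → m ∈ I ∧ m < a.tailStr) := by
  refine descends_congr (K := fun k => k ∈ I ∧ k < a.tailStr) ?_ ?_ hk
  · rintro k m ⟨hk, hk'⟩ ⟨b, hb, rfl, rfl⟩
    have := hj _ hk
    simp only [Finset.mem_insert, Finset.mem_union] at hb
    rcases hb with rfl | hb | hb
    · grind
    · exact ⟨(hL b hb).1, (hL b hb).2.1⟩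
    · grind [hU b hb, IsUpper]
  · rintro k m ⟨hk, hk'⟩
    have := hj _ hk
    constructor
    · rintro ⟨b, hb, rfl, rfl⟩
      simp only [Finset.mem_insert, Finset.mem_union] at hb
      rcases hb with rfl | hb | hb
      · grind
      · have := lowerMap_of_isLower hj (hL b hb)
        exact ⟨_, Finset.mem_image_of_mem _ hb, by grind⟩
      · grind [hU b hb, IsUpper]
    · rintro ⟨b', hb', rfl, rfl⟩
      obtain ⟨b, hb, rfl⟩ := Finset.mem_image.1 hb'
      have := lowerMap_of_isLower hj (hL b hb)
      exact ⟨b, by simp [hb], by grind⟩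

lemma descends_upper_iff (hj : ∀ x ∈ I, a.headStr < x) (hi : a.tailStr ∈ I)
    (hL : ∀ b ∈ L, IsLower I a b) (hU : ∀ b ∈ U, IsUpper I a b)
    {k m : Fin n} (hk : k ∈ I ∧ a.tailStr < k) :
    (Descends (insert a (L ∪ U)) k m ↔ Descends (U.image (upperMap a)) k m) ∧
      (Descends (insert a (L ∪ U)) k m → m ∈ I ∧ a.tailStr < m) := by
  refine descends_congr (K := fun k => k ∈ I ∧ a.tailStr < k) ?_ ?_ hk
  · rintro k m ⟨hk, hk'⟩ ⟨b, hb, rfl, rfl⟩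
    have := hj _ hk
    simp only [Finset.mem_insert, Finset.mem_union] at hb
    rcases hb with rfl | hb | hb
    · grind
    · grind [hL b hb, IsLower]
    · exact ⟨(hU b hb).1, (hU b hb).2.1⟩
  · rintro k m ⟨hk, hk'⟩
    have := hj _ hk
    constructor
    · rintro ⟨b, hb, rfl, rfl⟩
      simp only [Finset.mem_insert, Finset.mem_union] at hb
      rcases hb with rfl | hb | hb
      · grind
      · grind [hL b hb, IsLower]
      · have := upperMap_of_isUpper hj hi (hU b hb)
        exact ⟨_, Finset.mem_image_of_mem _ hb, by grind⟩
    · rintro ⟨b', hb', rfl, rfl⟩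
      obtain ⟨b, hb, rfl⟩ := Finset.mem_image.1 hb'
      have := upperMap_of_isUpper hj hi (hU b hb)
      exact ⟨b, by simp [hb], by grind⟩

lemma descends_tail_cases (hj : a.headStr < a.tailStr) {m : Fin n}
    (h : Descends (insert a (L ∪ U)) a.tailStr m) :
    m = a.tailStr ∨ ∃ d ∈ L ∪ U, d.headStr = a.tailStr ∧
      Descends (insert a (L ∪ U)) d.tailStr m := by
  rcases Relation.ReflTransGen.cases_head h with h | ⟨c, ⟨d, hd, rfl, hdh⟩, hc⟩
  · exact .inl h.symm
  · rcases Finset.mem_insert.1 hd with rfl | hd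
    · grind
    · exact .inr ⟨d, hd, hdh, hc⟩

end trees

section planarity

variable {n : ℕ} {I : Finset (Fin n)} {a : GArrow n} {L U : Finset (GArrow n)}

lemma existsUnique_image_iff {f : GArrow n → GArrow n} (hf : Function.Injective f)
    (ht : ∀ b ∈ L, (f b).tailStr = b.tailStr) (k : Fin n) :
    (∃! c, c ∈ L.image f ∧ c.tailStr = k) ↔ ∃! c, c ∈ L ∧ c.tailStr = k := by
  constructor
  · rintro ⟨c, ⟨hc, rfl⟩, hu⟩
    obtain ⟨b, hb, rfl⟩ := Finset.mem_image.1 hc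
    exact ⟨b, ⟨hb, (ht b hb).symm⟩, fun d hd =>
      hf (hu _ ⟨Finset.mem_image_of_mem _ hd.1, by rw [ht d hd.1, hd.2]⟩)⟩
  · rintro ⟨b, ⟨hb, rfl⟩, hu⟩
    refine ⟨f b, ⟨Finset.mem_image_of_mem _ hb, ht b hb⟩, ?_⟩
    rintro d ⟨hd, hd'⟩
    obtain ⟨e, he, rfl⟩ := Finset.mem_image.1 hd
    rw [hu e ⟨he, by rw [← ht e he, hd']⟩]

lemma existsUnique_congr_mem {S T : Finset (GArrow n)} {k : Fin n}
    (h : ∀ c : GArrow n, c.tailStr = k → (c ∈ S ↔ c ∈ T)) :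
    (∃! c, c ∈ S ∧ c.tailStr = k) ↔ ∃! c, c ∈ T ∧ c.tailStr = k :=
  existsUnique_congr fun c => by grind

lemma existsUnique_lower_iff (hj : ∀ x ∈ I, a.headStr < x) (hi : a.tailStr ∈ I)
    (hL : ∀ b ∈ L, IsLower I a b) (hU : ∀ b ∈ U, IsUpper I a b) {k : Fin n}
    (hk : k < a.tailStr) :
    (∃! c, c ∈ L.image (lowerMap a) ∧ c.tailStr = k) ↔
      ∃! c, c ∈ insert a (L ∪ U) ∧ c.tailStr = k := by
  rw [existsUnique_image_iff (lowerMap_injective (hj _ hi).ne) fun b hb =>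
    (lowerMap_of_isLower hj (hL b hb)).1]
  refine existsUnique_congr_mem fun c hc => ?_
  have := fun h => (hU c h).2.1
  simp only [Finset.mem_insert, Finset.mem_union]
  grind

lemma existsUnique_upper_iff (hj : ∀ x ∈ I, a.headStr < x) (hi : a.tailStr ∈ I)
    (hL : ∀ b ∈ L, IsLower I a b) (hU : ∀ b ∈ U, IsUpper I a b) {k : Fin n}
    (hk : a.tailStr < k) :
    (∃! c, c ∈ U.image (upperMap a) ∧ c.tailStr = k) ↔
      ∃! c, c ∈ insert a (L ∪ U) ∧ c.tailStr = k := by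
  rw [existsUnique_image_iff (upperMap_injective (hj _ hi).ne) fun b hb =>
    (upperMap_of_isUpper hj hi (hU b hb)).1]
  refine existsUnique_congr_mem fun c hc => ?_
  have := fun h => (hL c h).2.1
  simp only [Finset.mem_insert, Finset.mem_union]
  grind

lemma isTreeDiagram_images (hj : ∀ x ∈ I, a.headStr < x) (hi : a.tailStr ∈ I)
    (hL : ∀ b ∈ L, IsLower I a b) (hU : ∀ b ∈ U, IsUpper I a b)
    (h : IsTreeDiagram I a.headStr (insert a (L ∪ U))) :
    IsTreeDiagram (I.filter (· < a.tailStr)) a.headStr (L.image (lowerMap a)) ∧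
      IsTreeDiagram (I.filter (a.tailStr < ·)) a.tailStr (U.image (upperMap a)) := by
  have hji := hj _ hi
  have hl := fun b hb => lowerMap_of_isLower hj (hL b hb)
  have hu := fun b hb => upperMap_of_isUpper hj hi (hU b hb)
  have huL := fun k => existsUnique_lower_iff hj hi hL hU (k := k)
  have huU := fun k => existsUnique_upper_iff hj hi hL hU (k := k)
  simp only [IsLower] at hL
  simp only [IsUpper] at hU
  obtain ⟨h1, h2, h3, h4, h5⟩ := h
  simp only [Finset.mem_insert, Finset.mem_union] at h1 h3 h4 h5
  refine ⟨⟨?_, ?_, ?_, ?_, ?_⟩, ⟨?_, ?_, ?_, ?_, ?_⟩⟩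
  · simp only [Finset.forall_mem_image]
    intro b hb
    have := hj _ (hL b hb).1
    grind
  · intro k hk
    rw [Finset.mem_filter] at hk
    exact (huL k hk.2).2 (h2 k hk.1)
  · simp only [Finset.forall_mem_image, Finset.mem_filter]
    grind
  · simp only [Finset.forall_mem_image, Finset.mem_filter]
    grind
  · simp only [Finset.forall_mem_image]
    intro b hb c hc
    have := hj _ (hL c hc).1
    grind
  · simp only [Finset.forall_mem_image]
    grind
  · intro k hk
    rw [Finset.mem_filter] at hk
    exact (huU k hk.2).2 (h2 k hk.1)
  · simp only [Finset.forall_mem_image, Finset.mem_filter]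
    grind
  · simp only [Finset.forall_mem_image, Finset.mem_filter]
    grind
  · simp only [Finset.forall_mem_image]
    intro b hb c hc
    have := hj _ (hU c hc).1
    grind

lemma isTreeDiagram_insert (hj : ∀ x ∈ I, a.headStr < x) (hi : a.tailStr ∈ I)
    (hL : ∀ b ∈ L, IsLower I a b) (hU : ∀ b ∈ U, IsUpper I a b)
    (h : IsTreeDiagram (I.filter (· < a.tailStr)) a.headStr (L.image (lowerMap a)) ∧
      IsTreeDiagram (I.filter (a.tailStr < ·)) a.tailStr (U.image (upperMap a))) :
    IsTreeDiagram I a.headStr (insert a (L ∪ U)) := by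
  have hji := hj _ hi
  have hl := fun b hb => lowerMap_of_isLower hj (hL b hb)
  have hu := fun b hb => upperMap_of_isUpper hj hi (hU b hb)
  have huL := fun k => existsUnique_lower_iff hj hi hL hU (k := k)
  have huU := fun k => existsUnique_upper_iff hj hi hL hU (k := k)
  simp only [IsLower] at hL
  simp only [IsUpper] at hU
  obtain ⟨⟨h1, h2, h3, h4, h5⟩, ⟨g1, g2, g3, g4, g5⟩⟩ := h
  simp only [Finset.forall_mem_image, Finset.mem_filter] at h1 h3 h4 h5 g1 g3 g4 g5
  refine ⟨?_, ?_, ?_, ?_, ?_⟩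
  · intro b hb
    simp only [Finset.mem_insert, Finset.mem_union] at hb
    rcases hb with rfl | hb | hb
    · exact hji.ne'
    · have := hj _ (hL b hb).1
      grind
    · have := hj _ (hU b hb).1
      grind
  · intro k hk
    rcases lt_trichotomy k a.tailStr with h | rfl | h
    · exact (huL k h).1 (h2 k (by simp [hk, h]))
    · refine ⟨a, by simp, ?_⟩
      rintro b ⟨hb, hb'⟩
      simp only [Finset.mem_insert, Finset.mem_union] at hb
      grind
    · exact (huU k h).1 (g2 k (by simp [hk, h]))
  · simp only [Finset.mem_insert, Finset.mem_union]
    grind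
  · simp only [Finset.mem_insert, Finset.mem_union]
    grind
  · intro b hb c hc hbc
    simp only [Finset.mem_insert, Finset.mem_union] at hb hc
    have : a.headStr < c.tailStr := hj _ (by grind)
    rcases hb with rfl | hb | hb <;> rcases hc with rfl | hc | hc
    · grind
    · grind
    · grind
    · grind
    · have := h5 hb hc
      grind
    · grind
    · grind
    · grind
    · have := g5 hb hc
      grind

lemma transGen_insert_iff (hj : ∀ x ∈ I, a.headStr < x) (hi : a.tailStr ∈ I)
    (hL : ∀ b ∈ L, IsLower I a b) (hU : ∀ b ∈ U, IsUpper I a b) :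
    (∀ k ∈ I, Relation.TransGen (ParentRel (insert a (L ∪ U))) a.headStr k) ↔
      (∀ k ∈ I.filter (· < a.tailStr),
        Relation.TransGen (ParentRel (L.image (lowerMap a))) a.headStr k) ∧
      (∀ k ∈ I.filter (a.tailStr < ·),
        Relation.TransGen (ParentRel (U.image (upperMap a))) a.tailStr k) := by
  have hji := hj _ hi
  have hl := fun b hb => lowerMap_of_isLower hj (hL b hb)
  have hu := fun b hb => upperMap_of_isUpper hj hi (hU b hb)
  simp only [IsLower] at hL
  simp only [IsUpper] at hU
  have hja : ParentRel (insert a (L ∪ U)) a.headStr a.tailStr := ⟨a, by simp, rfl, rfl⟩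
  have hmemL : ∀ b ∈ L, b ∈ insert a (L ∪ U) := fun b hb => by simp [hb]
  have hmemU : ∀ b ∈ U, b ∈ insert a (L ∪ U) := fun b hb => by simp [hb]
  have fL : ∀ b ∈ L, ParentRel (L.image (lowerMap a)) (lowerMap a b).headStr b.tailStr :=
    fun b hb => ⟨_, Finset.mem_image_of_mem _ hb, (hl b hb).1, rfl⟩
  have fU : ∀ b ∈ U, ParentRel (U.image (upperMap a)) (upperMap a b).headStr b.tailStr :=
    fun b hb => ⟨_, Finset.mem_image_of_mem _ hb, (hu b hb).1, rfl⟩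
  constructor
  · intro h
    have key : ∀ k, Relation.TransGen (ParentRel (insert a (L ∪ U))) a.headStr k →
        (k < a.tailStr →
          Relation.TransGen (ParentRel (L.image (lowerMap a))) a.headStr k) ∧
        (a.tailStr < k →
          Relation.TransGen (ParentRel (U.image (upperMap a))) a.tailStr k) := by
      intro k hk
      induction hk with
      | single hr =>
        obtain ⟨b, hb, rfl, hbh⟩ := hr
        simp only [Finset.mem_insert, Finset.mem_union] at hb
        rcases hb with rfl | hb | hb
        · simp
        · have h1 := fL b hb
          rw [show (lowerMap a b).headStr = a.headStr by grind] at h1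
          exact ⟨fun _ => .single h1, by grind⟩
        · have h1 := fU b hb
          rw [show (upperMap a b).headStr = a.tailStr by grind] at h1
          exact ⟨by grind, fun _ => .single h1⟩
      | tail _ hr ih =>
        obtain ⟨b, hb, rfl, rfl⟩ := hr
        simp only [Finset.mem_insert, Finset.mem_union] at hb
        rcases hb with rfl | hb | hb
        · simp
        · have h1 := fL b hb
          refine ⟨fun _ => ?_, by grind⟩
          by_cases hc : (lowerMap a b).headStr = a.headStr
          · rw [hc] at h1
            exact .single h1
          · rw [show (lowerMap a b).headStr = b.headStr by grind] at h1
            exact (ih.1 (by grind)).tail h1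
        · have h1 := fU b hb
          refine ⟨by grind, fun _ => ?_⟩
          by_cases hc : (upperMap a b).headStr = a.tailStr
          · rw [hc] at h1
            exact .single h1
          · rw [show (upperMap a b).headStr = b.headStr by grind] at h1
            exact (ih.2 (by grind)).tail h1
    simp only [Finset.mem_filter]
    exact ⟨fun k hk => (key k (h k hk.1)).1 hk.2, fun k hk => (key k (h k hk.1)).2 hk.2⟩
  · rintro ⟨h1, h2⟩ k hk
    have key : ∀ m, (m = a.headStr ∨ m = a.tailStr ∨
        Relation.TransGen (ParentRel (insert a (L ∪ U))) a.headStr m) →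
        ∀ b ∈ insert a (L ∪ U), b.headStr = m →
        Relation.TransGen (ParentRel (insert a (L ∪ U))) a.headStr b.tailStr := by
      rintro m hm b hb rfl
      have hr : ParentRel (insert a (L ∪ U)) b.headStr b.tailStr := ⟨b, hb, rfl, rfl⟩
      rcases hm with hm | hm | hm
      · rw [hm] at hr
        exact .single hr
      · rw [hm] at hr
        exact (Relation.TransGen.single hja).tail hr
      · exact hm.tail hr
    have keyL : ∀ k, Relation.TransGen (ParentRel (L.image (lowerMap a))) a.headStr k →
        Relation.TransGen (ParentRel (insert a (L ∪ U))) a.headStr k := by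
      intro k hk
      induction hk with
      | single hr =>
        obtain ⟨b', hb', rfl, hh⟩ := hr
        obtain ⟨b, hb, rfl⟩ := Finset.mem_image.1 hb'
        rw [(hl b hb).1]
        exact key b.headStr (by grind) b (hmemL b hb) rfl
      | tail _ hr ih =>
        obtain ⟨b', hb', rfl, rfl⟩ := hr
        obtain ⟨b, hb, rfl⟩ := Finset.mem_image.1 hb'
        rw [(hl b hb).1]
        exact key b.headStr (by grind) b (hmemL b hb) rfl
    have keyU : ∀ k, Relation.TransGen (ParentRel (U.image (upperMap a))) a.tailStr k →
        Relation.TransGen (ParentRel (insert a (L ∪ U))) a.headStr k := by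
      intro k hk
      induction hk with
      | single hr =>
        obtain ⟨b', hb', rfl, hh⟩ := hr
        obtain ⟨b, hb, rfl⟩ := Finset.mem_image.1 hb'
        rw [(hu b hb).1]
        exact key b.headStr (by grind) b (hmemU b hb) rfl
      | tail _ hr ih =>
        obtain ⟨b', hb', rfl, rfl⟩ := hr
        obtain ⟨b, hb, rfl⟩ := Finset.mem_image.1 hb'
        rw [(hu b hb).1]
        exact key b.headStr (by grind) b (hmemU b hb) rfl
    rcases lt_trichotomy k a.tailStr with h | rfl | h
    · exact keyL k (h1 k (by simp [hk, h]))
    · exact .single hja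
    · exact keyU k (h2 k (by simp [hk, h]))

end planarity

section order

variable {n : ℕ} {I : Finset (Fin n)} {a : GArrow n} {L U : Finset (GArrow n)}

/-- The order conditions in the definition of a planar tree diagram. -/
def PlanarOrder (S : Finset (GArrow n)) : Prop :=
  (∀ a ∈ S, ∀ k : Fin n, Descends S a.tailStr k →
    (a.tailStr < a.headStr ↔ k < a.headStr)) ∧
  (∀ a ∈ S, ∀ b ∈ S, a.headStr = b.headStr → a.headPos < b.headPos →
    ∀ k k' : Fin n, Descends S a.tailStr k → Descends S b.tailStr k' →
      ((a.tailStr < a.headStr → b.tailStr < b.headStr → k' < k) ∧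
       (a.headStr < a.tailStr → b.headStr < b.tailStr → k < k')))

lemma isPlanarTreeDiagram_iff {j : Fin n} {S : Finset (GArrow n)} :
    IsPlanarTreeDiagram I j S ↔ IsTreeDiagram I j S ∧
      (∀ i ∈ I, Relation.TransGen (ParentRel S) j i) ∧ PlanarOrder S :=
  Iff.rfl

lemma planarOrder_lower (hj : ∀ x ∈ I, a.headStr < x) (hi : a.tailStr ∈ I)
    (hL : ∀ b ∈ L, IsLower I a b) (hU : ∀ b ∈ U, IsUpper I a b)
    (h : PlanarOrder (insert a (L ∪ U))) : PlanarOrder (L.image (lowerMap a)) := by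
  have hji := hj _ hi
  have hl := fun b hb => lowerMap_of_isLower hj (hL b hb)
  have hD : ∀ b ∈ L, ∀ k, Descends (L.image (lowerMap a)) (lowerMap a b).tailStr k →
      Descends (insert a (L ∪ U)) b.tailStr k ∧ k ∈ I ∧ k < a.tailStr := by
    intro b hb k hk
    rw [(hl b hb).1] at hk
    have := descends_lower_iff hj hi hL hU (m := k) ⟨(hL b hb).1, (hL b hb).2.1⟩
    exact ⟨this.1.2 hk, this.2 (this.1.2 hk)⟩
  have hmem : ∀ b ∈ L, b ∈ insert a (L ∪ U) := fun b hb => by simp [hb]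
  simp only [IsLower] at hL
  obtain ⟨h3, h4⟩ := h
  constructor
  · simp only [Finset.forall_mem_image]
    intro b hb k hk
    obtain ⟨hk1, hk2, hk3⟩ := hD b hb k hk
    have := h3 b (hmem b hb) k hk1
    have := hj _ hk2
    grind
  · simp only [Finset.forall_mem_image]
    intro b hb c hc hbc hpos k k' hk hk'
    obtain ⟨hk1, hk2, hk3⟩ := hD b hb k hk
    obtain ⟨hk1', hk2', hk3'⟩ := hD c hc k' hk'
    obtain ⟨hb1, -, hb3, hb4, -⟩ := hl b hb
    obtain ⟨hc1, -, hc3, hc4, -⟩ := hl c hc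
    have hLb := hL b hb
    have hLc := hL c hc
    have hjb := hj _ hLb.1
    have hjc := hj _ hLc.1
    by_cases hbi : b.headStr = a.tailStr <;> by_cases hci : c.headStr = a.tailStr
    · have := h4 c (hmem c hc) b (hmem b hb) (by grind) (by grind) k' k hk1' hk1
      grind
    · grind
    · have hd : Descends (insert a (L ∪ U)) a.tailStr k' :=
        .head ⟨c, hmem c hc, rfl, hci⟩ hk1'
      have := h4 b (hmem b hb) a (by simp) (by grind) (by grind) k k' hk1 hd
      grind
    · have := h4 b (hmem b hb) c (hmem c hc) (by grind) (by grind) k k' hk1 hk1'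
      grind

lemma planarOrder_upper (hj : ∀ x ∈ I, a.headStr < x) (hi : a.tailStr ∈ I)
    (hL : ∀ b ∈ L, IsLower I a b) (hU : ∀ b ∈ U, IsUpper I a b)
    (h : PlanarOrder (insert a (L ∪ U))) : PlanarOrder (U.image (upperMap a)) := by
  have hji := hj _ hi
  have hu := fun b hb => upperMap_of_isUpper hj hi (hU b hb)
  have hD : ∀ b ∈ U, ∀ k, Descends (U.image (upperMap a)) (upperMap a b).tailStr k →
      Descends (insert a (L ∪ U)) b.tailStr k ∧ k ∈ I ∧ a.tailStr < k := by
    intro b hb k hk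
    rw [(hu b hb).1] at hk
    have := descends_upper_iff hj hi hL hU (m := k) ⟨(hU b hb).1, (hU b hb).2.1⟩
    exact ⟨this.1.2 hk, this.2 (this.1.2 hk)⟩
  have hmem : ∀ b ∈ U, b ∈ insert a (L ∪ U) := fun b hb => by simp [hb]
  simp only [IsUpper] at hU
  obtain ⟨h3, h4⟩ := h
  constructor
  · simp only [Finset.forall_mem_image]
    intro b hb k hk
    obtain ⟨hk1, hk2, hk3⟩ := hD b hb k hk
    have := h3 b (hmem b hb) k hk1
    have := hj _ hk2
    grind
  · simp only [Finset.forall_mem_image]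
    intro b hb c hc hbc hpos k k' hk hk'
    obtain ⟨hk1, hk2, hk3⟩ := hD b hb k hk
    obtain ⟨hk1', hk2', hk3'⟩ := hD c hc k' hk'
    obtain ⟨hb1, -, hb3, hb4, -⟩ := hu b hb
    obtain ⟨hc1, -, hc3, hc4, -⟩ := hu c hc
    have hUb := hU b hb
    have hUc := hU c hc
    have hjb := hj _ hUb.1
    have hjc := hj _ hUc.1
    by_cases hbj : b.headStr = a.headStr <;> by_cases hcj : c.headStr = a.headStr
    · have := h4 b (hmem b hb) c (hmem c hc) (by grind) (by grind) k k' hk1 hk1'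
      grind
    · grind
    · by_cases hbi : b.headStr = a.tailStr
      · have hd : Descends (insert a (L ∪ U)) a.tailStr k :=
          .head ⟨b, hmem b hb, rfl, hbi⟩ hk1
        have := h4 a (by simp) c (hmem c hc) (by grind) (by grind) k k' hd hk1'
        grind
      · grind
    · have := h4 b (hmem b hb) c (hmem c hc) (by grind) (by grind) k k' hk1 hk1'
      grind

set_option maxHeartbeats 1000000 in
lemma planarOrder_insert (hj : ∀ x ∈ I, a.headStr < x) (hi : a.tailStr ∈ I)
    (hL : ∀ b ∈ L, IsLower I a b) (hU : ∀ b ∈ U, IsUpper I a b)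
    (h : PlanarOrder (L.image (lowerMap a))) (h' : PlanarOrder (U.image (upperMap a))) :
    PlanarOrder (insert a (L ∪ U)) := by
  have hji := hj _ hi
  have hl := fun b hb => lowerMap_of_isLower hj (hL b hb)
  have hu := fun b hb => upperMap_of_isUpper hj hi (hU b hb)
  have hDL : ∀ b ∈ L, ∀ k, Descends (insert a (L ∪ U)) b.tailStr k →
      Descends (L.image (lowerMap a)) (lowerMap a b).tailStr k ∧ k ∈ I ∧ k < a.tailStr := by
    intro b hb k hk
    rw [(hl b hb).1]
    have := descends_lower_iff hj hi hL hU (m := k) ⟨(hL b hb).1, (hL b hb).2.1⟩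
    exact ⟨this.1.1 hk, this.2 hk⟩
  have hDU : ∀ b ∈ U, ∀ k, Descends (insert a (L ∪ U)) b.tailStr k →
      Descends (U.image (upperMap a)) (upperMap a b).tailStr k ∧ k ∈ I ∧ a.tailStr < k := by
    intro b hb k hk
    rw [(hu b hb).1]
    have := descends_upper_iff hj hi hL hU (m := k) ⟨(hU b hb).1, (hU b hb).2.1⟩
    exact ⟨this.1.1 hk, this.2 hk⟩
  have hDa : ∀ k, Descends (insert a (L ∪ U)) a.tailStr k → k = a.tailStr ∨
      (∃ d ∈ L, d.headStr = a.tailStr ∧ Descends (insert a (L ∪ U)) d.tailStr k) ∨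
      (∃ d ∈ U, d.headStr = a.tailStr ∧ Descends (insert a (L ∪ U)) d.tailStr k) := by
    intro k hk
    rcases descends_tail_cases hji hk with h | ⟨d, hd, h⟩
    · exact .inl h
    · rcases Finset.mem_union.1 hd with hd | hd
      · exact .inr (.inl ⟨d, hd, h⟩)
      · exact .inr (.inr ⟨d, hd, h⟩)
  have mL : ∀ b ∈ L, lowerMap a b ∈ L.image (lowerMap a) :=
    fun b hb => Finset.mem_image_of_mem _ hb
  have mU : ∀ b ∈ U, upperMap a b ∈ U.image (upperMap a) :=
    fun b hb => Finset.mem_image_of_mem _ hb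
  simp only [IsLower] at hL
  simp only [IsUpper] at hU
  obtain ⟨h3, h4⟩ := h
  obtain ⟨g3, g4⟩ := h'
  constructor
  · intro b hb k hk
    simp only [Finset.mem_insert, Finset.mem_union] at hb
    rcases hb with rfl | hb | hb
    · rcases hDa k hk with rfl | ⟨d, hd, -, hdk⟩ | ⟨d, hd, -, hdk⟩
      · rfl
      · have := hj _ (hDL d hd k hdk).2.1
        grind
      · have := hj _ (hDU d hd k hdk).2.1
        grind
    · obtain ⟨hk1, hk2, hk3⟩ := hDL b hb k hk
      have := h3 _ (mL b hb) k hk1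
      have := hj _ hk2
      have := hj _ (hL b hb).1
      grind
    · obtain ⟨hk1, hk2, hk3⟩ := hDU b hb k hk
      have := g3 _ (mU b hb) k hk1
      have := hj _ hk2
      have := hj _ (hU b hb).1
      grind
  · intro b hb c hc hbc hpos k k' hk hk'
    simp only [Finset.mem_insert, Finset.mem_union] at hb hc
    rcases hb with rfl | hb | hb <;> rcases hc with rfl | hc | hc
    · exact absurd hpos (lt_irrefl _)
    · grind
    · obtain ⟨hk1', hk2', hk3'⟩ := hDU c hc k' hk'
      refine ⟨by grind, fun _ _ => ?_⟩
      rcases hDa k hk with rfl | ⟨d, hd, hdh, hdk⟩ | ⟨d, hd, hdh, hdk⟩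
      · exact hk3'
      · exact (hDL d hd k hdk).2.2.trans hk3'
      · have := g4 _ (mU d hd) _ (mU c hc) (by grind) (by grind) k k' (hDU d hd k hdk).1 hk1'
        grind
    · obtain ⟨hk1, hk2, hk3⟩ := hDL b hb k hk
      have hjb := hj _ (hL b hb).1
      refine ⟨by grind, fun _ _ => ?_⟩
      rcases hDa k' hk' with rfl | ⟨d, hd, hdh, hdk⟩ | ⟨d, hd, hdh, hdk⟩
      · exact hk3
      · have := hj _ (hL d hd).1
        have := h4 _ (mL b hb) _ (mL d hd) (by grind) (by grind) k k' hk1 (hDL d hd k' hdk).1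
        grind
      · exact hk3.trans (hDU d hd k' hdk).2.2
    · have hk1 := (hDL b hb k hk).1
      have hk1' := (hDL c hc k' hk').1
      have := hj _ (hL b hb).1
      have := hj _ (hL c hc).1
      by_cases hbi : b.headStr = a.tailStr
      · have := h4 _ (mL c hc) _ (mL b hb) (by grind) (by grind) k' k hk1' hk1
        grind
      · have := h4 _ (mL b hb) _ (mL c hc) (by grind) (by grind) k k' hk1 hk1'
        grind
    · have := (hDL b hb k hk).2
      have := (hDU c hc k' hk').2
      have := hj _ (hL b hb).1
      grind
    · grind
    · have := hj _ (hU b hb).1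
      have := hj _ (hL c hc).1
      grind
    · have hk1 := (hDU b hb k hk).1
      have hk1' := (hDU c hc k' hk').1
      have := hj _ (hU b hb).1
      have := hj _ (hU c hc).1
      have := g4 _ (mU b hb) _ (mU c hc) (by grind) (by grind) k k' hk1 hk1'
      grind

lemma isPlanarTreeDiagram_insert_iff (hj : ∀ x ∈ I, a.headStr < x) (hi : a.tailStr ∈ I)
    (hL : ∀ b ∈ L, IsLower I a b) (hU : ∀ b ∈ U, IsUpper I a b) :
    IsPlanarTreeDiagram I a.headStr (insert a (L ∪ U)) ↔
      IsPlanarTreeDiagram (I.filter (· < a.tailStr)) a.headStr (L.image (lowerMap a)) ∧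
      IsPlanarTreeDiagram (I.filter (a.tailStr < ·)) a.tailStr (U.image (upperMap a)) := by
  simp only [isPlanarTreeDiagram_iff]
  constructor
  · rintro ⟨h1, h2, h3⟩
    have h1' := isTreeDiagram_images hj hi hL hU h1
    have h2' := (transGen_insert_iff hj hi hL hU).1 h2
    exact ⟨⟨h1'.1, h2'.1, planarOrder_lower hj hi hL hU h3⟩,
      ⟨h1'.2, h2'.2, planarOrder_upper hj hi hL hU h3⟩⟩
  · rintro ⟨⟨h1, h2, h3⟩, ⟨g1, g2, g3⟩⟩
    exact ⟨isTreeDiagram_insert hj hi hL hU ⟨h1, g1⟩,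
      (transGen_insert_iff hj hi hL hU).2 ⟨h2, g2⟩, planarOrder_insert hj hi hL hU h3 g3⟩

/-- In a planar tree diagram, every arrow other than a given arrow `a` ending on the trunk
lies on one of the two sides of `a`. -/
lemma isLower_or_isUpper {S : Finset (GArrow n)} (hj : ∀ x ∈ I, a.headStr < x)
    (hi : a.tailStr ∈ I) (h : IsPlanarTreeDiagram I a.headStr (insert a S))
    (hS : ∀ b ∈ S, ∀ s t, b.ep s ≠ a.ep t) {b : GArrow n} (hb : b ∈ S) :
    IsLower I a b ∨ IsUpper I a b := by
  obtain ⟨⟨-, h2, h3, h4, h5⟩, hT, h6, h7⟩ := h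
  have ha : a ∈ insert a S := by simp
  have hbS : b ∈ insert a S := by simp [hb]
  have hji := hj _ hi
  have hba : ∀ b ∈ S, b ≠ a := fun b hb h => hS b hb true true (by rw [h])
  have htail : ∀ b ∈ S, b.tailStr ≠ a.tailStr := fun b hb h =>
    hba b hb ((h2 _ hi).unique ⟨by simp [hb], h⟩ ⟨ha, rfl⟩)
  have hpos : ∀ b ∈ S, b.headStr = a.headStr → b.headPos ≠ a.headPos := by
    intro b hb h h'
    exact hS b hb true true (by simp [GArrow.ep, h, h'])
  have hside : ∀ c ∈ S, c.headStr = a.headStr → ∀ k, Descends (insert a S) c.tailStr k →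
      (c.headPos < a.headPos ∧ k < a.tailStr) ∨ (a.headPos < c.headPos ∧ a.tailStr < k) := by
    intro c hc hch k hk
    have hcS : c ∈ insert a S := by simp [hc]
    have := hj _ (h3 c hcS)
    rcases lt_or_gt_of_ne (hpos c hc hch) with hlt | hlt
    · have := h7 c hcS a ha hch hlt k a.tailStr hk .refl
      grind
    · have := h7 a ha c hcS hch.symm hlt a.tailStr k .refl hk
      grind
  have hbI := h3 b hbS
  rcases h4 b hbS with hh | hh
  · by_cases hbi : b.headStr = a.tailStr
    · have := h5 b hbS a ha hbi
      have := htail b hb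
      unfold IsLower IsUpper
      grind
    · have key : b.tailStr < a.tailStr ↔ b.headStr < a.tailStr := by
        have hstep : ParentRel (insert a S) b.headStr b.tailStr := ⟨b, hbS, rfl, rfl⟩
        obtain ⟨_, ⟨c, hc, rfl, hch⟩, hd⟩ := Relation.TransGen.head'_iff.1 (hT _ hh)
        rcases Finset.mem_insert.1 hc with rfl | hc'
        · rcases Relation.ReflTransGen.cases_head hd with h | ⟨_, ⟨d, hdS, rfl, hdh⟩, hd'⟩
          · exact absurd h.symm hbi
          · have e1 := h6 d hdS _ hd'
            have e2 := h6 d hdS _ (hd'.tail hstep)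
            grind
        · have e1 := hside c hc' hch _ hd
          have e2 := hside c hc' hch _ (hd.tail hstep)
          grind
      have := htail b hb
      unfold IsLower IsUpper
      grind
  · have := hside b hb hh _ .refl
    unfold IsLower IsUpper
    grind

end order

section weights

variable {n : ℕ} {I : Finset (Fin n)} {a b : GArrow n}

/-- The contribution of an arrow to the weight of a tree diagram. -/
noncomputable def arrowWeight (b : GArrow n) : ℤ :=
  (if b.tailStr < b.headStr then -1 else 1) * b.sign

lemma treeSign_mul_prod_sign (S : Finset (GArrow n)) :
    treeSign S * ∏ b ∈ S, b.sign = ∏ b ∈ S, arrowWeight b := by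
  simp only [treeSign, arrowWeight, Finset.prod_mul_distrib, Finset.prod_ite,
    Finset.prod_const, one_pow, mul_one]

lemma arrowWeight_lowerMap (hj : ∀ x ∈ I, a.headStr < x) (h : IsLower I a b) :
    arrowWeight (lowerMap a b) = arrowWeight b := by
  have := hj _ h.1
  have := h.2.1
  have := lowerMap_of_isLower hj h
  unfold arrowWeight
  grind

lemma arrowWeight_upperMap (hj : ∀ x ∈ I, a.headStr < x) (hi : a.tailStr ∈ I)
    (h : IsUpper I a b) : arrowWeight (upperMap a b) = arrowWeight b := by
  have := hj _ h.1
  have := h.2.1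
  have := upperMap_of_isUpper hj hi h
  unfold arrowWeight
  grind

end weights

section skein

variable {n : ℕ} {I : Finset (Fin n)} {a : GArrow n} {E : Finset (GArrow n)}

/-- The tree invariant of a finite set of arrows. -/
noncomputable def treeSum (I : Finset (Fin n)) (j : Fin n) (A : Finset (GArrow n)) : ℤ :=
  ∑ S ∈ A.powerset with IsPlanarTreeDiagram I j S, ∏ b ∈ S, arrowWeight b

lemma Z_eq_treeSum (I : Finset (Fin n)) (j : Fin n) (G : GaussDiagram n) :
    Z I j G = treeSum I j G.arrows := by
  simp only [Z, treeSum, Finset.sum_filter, treeSign_mul_prod_sign]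

lemma treeSum_image (I : Finset (Fin n)) (j : Fin n) {f : GArrow n → GArrow n}
    (hf : Function.Injective f) (A : Finset (GArrow n)) :
    treeSum I j (A.image f) =
      ∑ S ∈ A.powerset with IsPlanarTreeDiagram I j (S.image f), ∏ b ∈ S, arrowWeight (f b) := by
  simp only [treeSum, Finset.sum_filter]
  rw [Finset.powerset_image, Finset.sum_image (Finset.image_injective hf).injOn]
  refine Finset.sum_congr rfl fun S _ => ?_
  rw [Finset.prod_image hf.injOn]

lemma treeSum_insert (j : Fin n) (ha : a ∉ E) :
    treeSum I j (insert a E) = treeSum I j E +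
      ∑ S ∈ E.powerset with IsPlanarTreeDiagram I j (insert a S),
        ∏ b ∈ insert a S, arrowWeight b := by
  simp only [treeSum, Finset.sum_filter, Finset.sum_powerset_insert ha]

lemma forall_isLower_of_image {L : Finset (GArrow n)} (hj : ∀ x ∈ I, a.headStr < x)
    (hi : a.tailStr ∈ I) (hL : ∀ b ∈ L, ∀ s t, b.ep s ≠ a.ep t)
    (h : IsPlanarTreeDiagram (I.filter (· < a.tailStr)) a.headStr (L.image (lowerMap a))) :
    ∀ b ∈ L, IsLower I a b := by
  intro b hb
  have hm := Finset.mem_image_of_mem (lowerMap a) hb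
  exact isLower_of_lowerMap hj hi (hL b hb) (h.1.2.2.1 _ hm) (h.1.2.2.2.1 _ hm)

lemma forall_isUpper_of_image {U : Finset (GArrow n)} (hj : ∀ x ∈ I, a.headStr < x)
    (hi : a.tailStr ∈ I) (hU : ∀ b ∈ U, ∀ s t, b.ep s ≠ a.ep t)
    (h : IsPlanarTreeDiagram (I.filter (a.tailStr < ·)) a.tailStr (U.image (upperMap a))) :
    ∀ b ∈ U, IsUpper I a b := by
  intro b hb
  have hm := Finset.mem_image_of_mem (upperMap a) hb
  exact isUpper_of_upperMap hj hi (hU b hb) (h.1.2.2.1 _ hm) (h.1.2.2.2.1 _ hm)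

/-- The skein relation for the tree invariants. -/
lemma treeSum_skein (hj : ∀ x ∈ I, a.headStr < x) (hi : a.tailStr ∈ I)
    (hE : ∀ b ∈ E, ∀ s t, b.ep s ≠ a.ep t) :
    treeSum I a.headStr (insert a E) = treeSum I a.headStr E +
      a.sign * (treeSum (I.filter (· < a.tailStr)) a.headStr (E.image (lowerMap a)) *
        treeSum (I.filter (a.tailStr < ·)) a.tailStr (E.image (upperMap a))) := by
  have hji := hj _ hi
  have haE : a ∉ E := fun h => hE a h true true rfl
  rw [treeSum_insert _ haE, treeSum_image _ _ (lowerMap_injective hji.ne),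
    treeSum_image _ _ (upperMap_injective hji.ne), Finset.sum_mul_sum, ← Finset.sum_product',
    Finset.mul_sum]
  congr 1
  have split : ∀ S : Finset (GArrow n), (∀ b ∈ S, IsLower I a b ∨ IsUpper I a b) →
      S.filter (·.tailStr < a.tailStr) ∪ S.filter (a.tailStr < ·.tailStr) = S ∧
      (∀ b ∈ S.filter (·.tailStr < a.tailStr), IsLower I a b) ∧
      (∀ b ∈ S.filter (a.tailStr < ·.tailStr), IsUpper I a b) := by
    intro S hS
    have h1 : ∀ b, IsLower I a b → b.tailStr < a.tailStr := fun b h => h.2.1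
    have h2 : ∀ b, IsUpper I a b → a.tailStr < b.tailStr := fun b h => h.2.1
    refine ⟨?_, ?_, ?_⟩
    · ext b
      simp only [Finset.mem_union, Finset.mem_filter]
      grind
    · intro b hb
      rw [Finset.mem_filter] at hb
      grind
    · intro b hb
      rw [Finset.mem_filter] at hb
      grind
  have split' : ∀ S ⊆ E, IsPlanarTreeDiagram I a.headStr (insert a S) →
      ∀ b ∈ S, IsLower I a b ∨ IsUpper I a b := fun S hS h b hb =>
    isLower_or_isUpper hj hi h (fun b hb => hE b (hS hb)) hb
  have lower : ∀ L ⊆ E, _ → ∀ b ∈ L, IsLower I a b := fun L hL h =>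
    forall_isLower_of_image hj hi (fun b hb => hE b (hL hb)) h
  have upper : ∀ U ⊆ E, _ → ∀ b ∈ U, IsUpper I a b := fun U hU h =>
    forall_isUpper_of_image hj hi (fun b hb => hE b (hU hb)) h
  refine Finset.sum_bij' (fun S _ => (S.filter (·.tailStr < a.tailStr),
    S.filter (a.tailStr < ·.tailStr))) (fun p _ => p.1 ∪ p.2) ?_ ?_ ?_ ?_ ?_
  · intro S hS
    simp only [Finset.mem_filter, Finset.mem_powerset] at hS
    obtain ⟨e, hL, hU⟩ := split S (split' S hS.1 hS.2)
    have := hS.2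
    rw [← e, isPlanarTreeDiagram_insert_iff hj hi hL hU] at this
    simp only [Finset.mem_product, Finset.mem_filter, Finset.mem_powerset]
    exact ⟨⟨(Finset.filter_subset _ _).trans hS.1, this.1⟩,
      ⟨(Finset.filter_subset _ _).trans hS.1, this.2⟩⟩
  · rintro ⟨L, U⟩ h
    simp only [Finset.mem_product, Finset.mem_filter, Finset.mem_powerset] at h ⊢
    obtain ⟨⟨hL, hL'⟩, ⟨hU, hU'⟩⟩ := h
    exact ⟨Finset.union_subset hL hU, (isPlanarTreeDiagram_insert_iff hj hi
      (lower L hL hL') (upper U hU hU')).2 ⟨hL', hU'⟩⟩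
  · intro S hS
    simp only [Finset.mem_filter, Finset.mem_powerset] at hS
    exact (split S (split' S hS.1 hS.2)).1
  · rintro ⟨L, U⟩ h
    simp only [Finset.mem_product, Finset.mem_filter, Finset.mem_powerset] at h
    obtain ⟨⟨hL, hL'⟩, ⟨hU, hU'⟩⟩ := h
    have h1 := fun b hb => (lower L hL hL' b hb).2.1
    have h2 := fun b hb => (upper U hU hU' b hb).2.1
    ext b <;> simp only [Finset.mem_union, Finset.mem_filter] <;> grind
  · intro S hS
    simp only [Finset.mem_filter, Finset.mem_powerset] at hS
    obtain ⟨e, hL, hU⟩ := split S (split' S hS.1 hS.2)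
    have hdisj : Disjoint (S.filter (·.tailStr < a.tailStr))
        (S.filter (a.tailStr < ·.tailStr)) := by
      rw [Finset.disjoint_filter]
      exact fun b _ h h' => lt_asymm h h'
    rw [Finset.prod_insert fun h => haE (hS.1 h),
      Finset.prod_congr rfl fun b hb => arrowWeight_lowerMap hj (hL b hb),
      Finset.prod_congr rfl fun b hb => arrowWeight_upperMap hj hi (hU b hb),
      ← Finset.prod_union hdisj, e]
    simp [arrowWeight, hji.le]

lemma treeSum_erase {j : Fin n} {A : Finset (GArrow n)}
    (h : ¬(a.tailStr ∈ I ∧ (a.headStr ∈ I ∨ a.headStr = j) ∧ a.tailStr ≠ a.headStr)) :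
    treeSum I j (A.erase a) = treeSum I j A := by
  unfold treeSum
  congr 1
  ext S
  simp only [Finset.mem_filter, Finset.mem_powerset, and_congr_left_iff]
  refine fun hS => ⟨fun h' => h'.trans (Finset.erase_subset _ _), fun h' b hb => ?_⟩
  refine Finset.mem_erase.2 ⟨?_, h' hb⟩
  rintro rfl
  exact h ⟨hS.1.2.2.1 _ hb, hS.1.2.2.2.1 _ hb, hS.1.1 _ hb⟩

lemma treeSum_empty (j : Fin n) (A : Finset (GArrow n)) : treeSum ∅ j A = 1 := by
  have : A.powerset.filter (IsPlanarTreeDiagram ∅ j) = {∅} := by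
    ext S
    simp only [Finset.mem_filter, Finset.mem_powerset, Finset.mem_singleton]
    constructor
    · rintro ⟨-, h⟩
      exact Finset.eq_empty_of_forall_notMem fun b hb => by simpa using h.1.2.2.1 b hb
    · rintro rfl
      simp [IsPlanarTreeDiagram, IsTreeDiagram]
  rw [treeSum, this]
  simp

lemma treeSum_eq_zero {j : Fin n} {A : Finset (GArrow n)} (hI : I.Nonempty)
    (hA : ∀ b ∈ A, b.headStr ≠ j) : treeSum I j A = 0 := by
  obtain ⟨i, hi⟩ := hI
  refine Finset.sum_eq_zero fun S hS => ?_
  simp only [Finset.mem_filter, Finset.mem_powerset] at hS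
  obtain ⟨_, ⟨c, hc, -, hch⟩, -⟩ := Relation.TransGen.head'_iff.1 (hS.2.2.1 i hi)
  exact absurd hch (hA c (hS.1 hc))

end skein

section construction

variable {n : ℕ} {a : GArrow n}

/-- The image of a Gauss diagram under a map of arrows that is injective on endpoints. -/
noncomputable def mapArrows (G : GaussDiagram n) (f : GArrow n → GArrow n)
    (hs : ∀ b, (f b).sign = b.sign ∨ (f b).sign = -b.sign)
    (he : ∀ b c s t, (f b).ep s = (f c).ep t → b.ep s = c.ep t) : GaussDiagram n where
  arrows := G.arrows.image f
  sign_pm := by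
    simp only [Finset.forall_mem_image]
    intro b hb
    have := G.sign_pm b hb
    have := hs b
    omega
  endpoints_distinct := by
    simp only [Finset.forall_mem_image]
    intro b hb c hc s t h
    obtain ⟨rfl, rfl⟩ := G.endpoints_distinct b hb c hc s t (he b c s t h)
    exact ⟨rfl, rfl⟩

/-- Deletion of an arrow. -/
def eraseArrow (G : GaussDiagram n) (a : GArrow n) : GaussDiagram n where
  arrows := G.arrows.erase a
  sign_pm b hb := G.sign_pm b (Finset.mem_of_mem_erase hb)
  endpoints_distinct b hb c hc :=
    G.endpoints_distinct b (Finset.mem_of_mem_erase hb) c (Finset.mem_of_mem_erase hc)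

/-- The oriented smoothing at the arrow `a`. -/
noncomputable def upper (G : GaussDiagram n) (h : a.headStr ≠ a.tailStr) : GaussDiagram n :=
  (G.eraseArrow a).mapArrows (upperMap a) (fun _ => .inl rfl) fun b c s t hbc => by
    rw [upperMap, upperMap, ep_smoothArrow, ep_smoothArrow] at hbc
    exact (smoothEp_involutive h _ _).injective hbc

/-- The smoothing at the arrow `a` after reversing the string of its tail. -/
noncomputable def lower (G : GaussDiagram n) (h : a.headStr ≠ a.tailStr) : GaussDiagram n :=
  (G.eraseArrow a).mapArrows (lowerMap a)
    (fun b => by simp only [lowerMap, smoothArrow, reverseArrow]; grind)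
    fun b c s t hbc => by
      rw [lowerMap, lowerMap, ep_smoothArrow, ep_smoothArrow] at hbc
      exact ep_eq_of_reverseArrow ((smoothEp_involutive h _ _).injective hbc)

/-- The arrow `a` with its tail and head exchanged and its sign changed. -/
def switchArrow (a : GArrow n) : GArrow n :=
  ⟨a.headStr, a.headPos, a.tailStr, a.tailPos, -a.sign⟩

lemma ep_switchArrow (s : Bool) : (switchArrow a).ep s = a.ep (!s) := by
  cases s <;> rfl

lemma ep_ne_of_mem_erase {G : GaussDiagram n} (ha : a ∈ G.arrows) {b : GArrow n}
    (hb : b ∈ G.arrows.erase a) (s t : Bool) : b.ep s ≠ a.ep t := fun h =>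
  Finset.ne_of_mem_erase hb (G.endpoints_distinct b (Finset.mem_of_mem_erase hb) a ha s t h).1

lemma switchArrow_notMem_erase {G : GaussDiagram n} (ha : a ∈ G.arrows) :
    switchArrow a ∉ G.arrows.erase a := fun h =>
  ep_ne_of_mem_erase ha h false true (ep_switchArrow false)

/-- The crossing change at the arrow `a`. -/
noncomputable def switch (G : GaussDiagram n) (ha : a ∈ G.arrows) : GaussDiagram n where
  arrows := insert (switchArrow a) (G.arrows.erase a)
  sign_pm b hb := by
    rcases Finset.mem_insert.1 hb with rfl | hb
    · have := G.sign_pm a ha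
      simp only [switchArrow]
      omega
    · exact G.sign_pm b (Finset.mem_of_mem_erase hb)
  endpoints_distinct b hb c hc s t h := by
    rcases Finset.mem_insert.1 hb with rfl | hb <;> rcases Finset.mem_insert.1 hc with rfl | hc
    · rw [ep_switchArrow, ep_switchArrow] at h
      simpa using (G.endpoints_distinct a ha a ha _ _ h).2
    · rw [ep_switchArrow] at h
      exact absurd h.symm (ep_ne_of_mem_erase ha hc _ _)
    · rw [ep_switchArrow] at h
      exact absurd h (ep_ne_of_mem_erase ha hb _ _)
    · exact G.endpoints_distinct b (Finset.mem_of_mem_erase hb) c (Finset.mem_of_mem_erase hc)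
        s t h

lemma isSkeinQuadruple_of_pos {G : GaussDiagram n} (ha : a ∈ G.arrows)
    (h : a.headStr ≠ a.tailStr) (hs : a.sign = 1) :
    IsSkeinQuadruple a.headStr a.tailStr G (G.switch ha) (G.upper h) (G.lower h) := by
  refine ⟨h, a, ha, hs, .inr ⟨rfl, rfl⟩, ?_, ?_, ?_⟩
  · simp [switch, switchArrow, hs]
  · simp [upper, mapArrows, eraseArrow, posOn, h.symm]
    rfl
  · rw [← Finset.image_erase (reverseArrow_involutive _).injective, Finset.image_image]
    simp [lower, mapArrows, eraseArrow, posOn, h.symm, Function.comp_def]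
    rfl

lemma isSkeinQuadruple_of_neg {G : GaussDiagram n} (ha : a ∈ G.arrows)
    (h : a.headStr ≠ a.tailStr) (hs : a.sign = -1) :
    IsSkeinQuadruple a.headStr a.tailStr (G.switch ha) G (G.upper h) (G.lower h) := by
  have he : (G.switch ha).arrows.erase (switchArrow a) = G.arrows.erase a :=
    Finset.erase_insert (switchArrow_notMem_erase ha)
  refine ⟨h, switchArrow a, Finset.mem_insert_self _ _, by simp [switchArrow, hs],
    .inl ⟨rfl, rfl⟩, ?_, ?_, ?_⟩
  · rw [he, ← hs]
    exact (Finset.insert_erase ha).symm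
  · rw [he]
    simp [upper, mapArrows, eraseArrow, posOn, switchArrow, h]
    rfl
  · rw [← Finset.image_erase (reverseArrow_involutive _).injective, he, Finset.image_image]
    simp [lower, mapArrows, eraseArrow, posOn, switchArrow, h, Function.comp_def]
    rfl

end construction

end GaussDiagram

/-- **Axiomatic characterization of the tree invariants** (the content of the
identification of the tree invariants with Milnor's μ-invariants).  Suppose
that for each `I ⊆ {1,…,n}` and each `j` with `j < min I`, `F I j` is a
ℤ-valued function of Gauss diagrams on `n` strings such that:
 (i) `F ∅ j ≡ 1`;
 (ii) each `F I j` is invariant under the Reidemeister moves `Ω1`, `Ω2`, `Ω3`;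
 (iii) `F I j G` is unchanged when one deletes from `G` any arrow that does not
   have its tail on a string of `I` and its head on a different string of
   `I ∪ {j}`;
 (iv) for every `i = i_k ∈ I` and every skein quadruple `(G₊, G₋, G₀, G_∞)` at
   a crossing between strings `j` and `i`,
   `F I j G₊ − F I j G₋ = F {x ∈ I : x < i} j G_∞ · F {x ∈ I : x > i} i G₀`;
 (v) `F I j G = 0` whenever `I ≠ ∅` and no arrow of `G` has its head on
   string `j`.
Then `F I j G = Z I j G` for every Gauss diagram `G`, every `I` and every
`j < min I`. -/
theorem axiomatic_characterization {n : ℕ}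
    (F : Finset (Fin n) → Fin n → GaussDiagram n → ℤ)
    (h_one : ∀ (j : Fin n) (G : GaussDiagram n), F ∅ j G = 1)
    (h_moves : ∀ (I : Finset (Fin n)) (j : Fin n), (∀ x ∈ I, j < x) →
      ∀ G G' : GaussDiagram n, ReidMove G G' → F I j G = F I j G')
    (h_del : ∀ (I : Finset (Fin n)) (j : Fin n), (∀ x ∈ I, j < x) →
      ∀ (G G' : GaussDiagram n) (a : GArrow n), a ∈ G.arrows →
        ¬(a.tailStr ∈ I ∧ (a.headStr ∈ I ∨ a.headStr = j) ∧
            a.tailStr ≠ a.headStr) →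
        G'.arrows = G.arrows.erase a → F I j G' = F I j G)
    (h_skein : ∀ (I : Finset (Fin n)) (j : Fin n), (∀ x ∈ I, j < x) →
      ∀ i ∈ I, ∀ Gp Gm G0 Ginf : GaussDiagram n,
        IsSkeinQuadruple j i Gp Gm G0 Ginf →
        F I j Gp - F I j Gm
          = F (I.filter (· < i)) j Ginf * F (I.filter (i < ·)) i G0)
    (h_norm : ∀ (I : Finset (Fin n)) (j : Fin n), (∀ x ∈ I, j < x) →
      I.Nonempty → ∀ G : GaussDiagram n,
        (∀ a ∈ G.arrows, a.headStr ≠ j) → F I j G = 0) :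
    ∀ (I : Finset (Fin n)) (j : Fin n), (∀ x ∈ I, j < x) →
      ∀ G : GaussDiagram n, F I j G = Z I j G := by
  intro I
  induction hr : I.card using Nat.strong_induction_on generalizing I with
  | _ r ihI =>
  intro j hj G
  induction hm : G.arrows.card using Nat.strong_induction_on generalizing G with
  | _ m ihG =>
  subst hr hm
  simp only [GaussDiagram.Z_eq_treeSum] at ihI ihG ⊢
  rcases I.eq_empty_or_nonempty with rfl | hI
  · rw [h_one, GaussDiagram.treeSum_empty]
  by_cases hhead : ∀ a ∈ G.arrows, a.headStr ≠ j
  · rw [h_norm I j hj hI G hhead, GaussDiagram.treeSum_eq_zero hI hhead]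
  push Not at hhead
  obtain ⟨a, ha, rfl⟩ := hhead
  have hrec := ihG _ (Finset.card_erase_lt_of_mem ha) (G.eraseArrow a) rfl
  by_cases hi : a.tailStr ∈ I
  · have hji := hj _ hi
    have hskein := GaussDiagram.treeSum_skein hj hi
      fun b hb => GaussDiagram.ep_ne_of_mem_erase ha hb
    rw [Finset.insert_erase ha] at hskein
    have hlow := ihI (I.filter (· < a.tailStr)).card
      (Finset.card_lt_card (Finset.filter_ssubset.2 ⟨_, hi, lt_irrefl _⟩)) _ rfl a.headStr
      (fun x hx => hj x (Finset.mem_of_mem_filter x hx)) (G.lower hji.ne)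
    have hupp := ihI (I.filter (a.tailStr < ·)).card
      (Finset.card_lt_card (Finset.filter_ssubset.2 ⟨_, hi, lt_irrefl _⟩)) _ rfl a.tailStr
      (fun x hx => (Finset.mem_filter.1 hx).2) (G.upper hji.ne)
    have hswitch := h_del I a.headStr hj (G.switch ha) (G.eraseArrow a)
      (GaussDiagram.switchArrow a) (Finset.mem_insert_self _ _)
      (fun h => lt_irrefl _ (hj _ h.1))
      (Finset.erase_insert (GaussDiagram.switchArrow_notMem_erase ha)).symm
    change _ = _ + a.sign * (GaussDiagram.treeSum _ _ (G.lower hji.ne).arrows *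
      GaussDiagram.treeSum _ _ (G.upper hji.ne).arrows) at hskein
    change _ = GaussDiagram.treeSum _ _ (G.arrows.erase a) at hrec
    rw [hskein, ← hrec, ← hlow, ← hupp]
    rcases G.sign_pm a ha with hs | hs
    · have := h_skein I a.headStr hj a.tailStr hi _ _ _ _
        (GaussDiagram.isSkeinQuadruple_of_pos ha hji.ne hs)
      rw [hs]
      linarith
    · have := h_skein I a.headStr hj a.tailStr hi _ _ _ _
        (GaussDiagram.isSkeinQuadruple_of_neg ha hji.ne hs)
      rw [hs]
      linarith
  · rw [← h_del I a.headStr hj G (G.eraseArrow a) a ha (fun h => hi h.1) rfl, hrec]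
    exact GaussDiagram.treeSum_erase fun h => hi h.1
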